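/- (Unconditional stability of the ADI scheme.) Let $T>0$, let $N\ge1$ be an integer with $\tau=T/N$, let $K\ge1$, $\Delta\beta>0$, $\beta_1,\dots,\beta_K\in(1,2)$, $p_1,\dots,p_K>0$, set $a_k^{(\beta_l)}=(k+1)^{2-\beta_l}-k^{2-\beta_l}$ and $\mu=\Delta\beta\sum_{l=1}^{K}p_l\frac{\tau^{-\beta_l}}{\Gamma(3-\beta_l)}$. Let $f:\{1,\dots,M_1-1\}\times\{1,\dots,M_2-1\}\times\mathbb{R}\times\mathbb{R}\to\mathbb{R}$ satisfy $|f(i,j,t,u_1)-f(i,j,t,u_2)|\le L_f|u_1-u_2|$ for a constant $L_f>0$. Suppose $u^0,\dots,u^N$ and $\tilde u^0,\dots,\tilde u^N$ are grid functions with $u^n_{ij}=\tilde u^n_{ij}$ for all boundary indices $(i,j)$ and all $n$, and that, with source data $\psi_2$ and $\tilde\psi_2$ respectively, each satisfies for all interior $(i,j)$ and $1\le n\le N$ the difference scheme $\Delta\beta\sum_{l=1}^{K}p_l\frac{\tau^{1-\beta_l}}{\Gamma(3-\beta_l)}\big[a_0^{(\beta_l)}\delta_t u^{n-1/2}_{ij}-\sum_{k=1}^{n-1}(a_{n-k-1}^{(\beta_l)}-a_{n-k}^{(\beta_l)})\delta_t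 u^{k-1/2}_{ij}-a_{n-1}^{(\beta_l)}(\psi_2)_{ij}\big]+\frac{1}{4\mu}\delta_x^2\delta_y^2(u^n_{ij}-u^{n-1}_{ij})=\delta_x^2 u^{n-1/2}_{ij}+\delta_y^2 u^{n-1/2}_{ij}+f(i,j,t_{n-1},u^{n-1}_{ij})$. Then, writing $\varepsilon^n=u^n-\tilde u^n$ and $\psi_2^{*}=\psi_2-\tilde\psi_2$, there exists a constant $C>0$ depending only on $T$, $L_f$, $L_1$, $L_2$, $K$, $\Delta\beta$, the $\beta_l$ and the $p_l$ (and not on $\tau$, $h_1$, $h_2$, or $n$) such that $\|\varepsilon^n\|^2\le C\big(\|\Delta_h\varepsilon^0\|^2+\|\psi_2^{*}\|^2\big)$ for all $1\le n\le N$. -/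

import Mathlib

open Finset

/-- Second difference in the x-direction. -/
noncomputable def deltaXSq (h₁ : ℝ) (w : ℕ → ℕ → ℝ) (i j : ℕ) : ℝ :=
  (w (i + 1) j - 2 * w i j + w (i - 1) j) / h₁ ^ 2

/-- Second difference in the y-direction. -/
noncomputable def deltaYSq (h₂ : ℝ) (w : ℕ → ℕ → ℝ) (i j : ℕ) : ℝ :=
  (w i (j + 1) - 2 * w i j + w i (j - 1)) / h₂ ^ 2

/-- Squared discrete L² norm of a grid function. -/
noncomputable def gridNormSq (h₁ h₂ : ℝ) (M₁ M₂ : ℕ) (v : ℕ → ℕ → ℝ) : ℝ :=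
  h₁ * h₂ * ∑ i ∈ Finset.Icc 1 (M₁ - 1), ∑ j ∈ Finset.Icc 1 (M₂ - 1), (v i j) ^ 2

/-- Squared discrete L² norm of the discrete Laplacian Δ_h v = δₓ²v + δ_y²v. -/
noncomputable def lapNormSq (h₁ h₂ : ℝ) (M₁ M₂ : ℕ) (v : ℕ → ℕ → ℝ) : ℝ :=
  h₁ * h₂ * ∑ i ∈ Finset.Icc 1 (M₁ - 1), ∑ j ∈ Finset.Icc 1 (M₂ - 1),
      (deltaXSq h₁ v i j + deltaYSq h₂ v i j) ^ 2

/-- The coefficients a_k^{(β)} = (k+1)^{2-β} - k^{2-β}. -/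
noncomputable def aCoef (β : ℝ) (k : ℕ) : ℝ :=
  ((k : ℝ) + 1) ^ (2 - β) - (k : ℝ) ^ (2 - β)

/-- `u` (with initial-velocity data `ψ₂`) satisfies the ADI difference scheme at every
interior point and every time level `1 ≤ n ≤ N`. -/
noncomputable def SatisfiesScheme (M₁ M₂ N K : ℕ) (h₁ h₂ τ Δβ μ : ℝ) (β p : ℕ → ℝ)
    (f : ℕ → ℕ → ℝ → ℝ → ℝ) (u : ℕ → ℕ → ℕ → ℝ) (ψ₂ : ℕ → ℕ → ℝ) : Prop :=
  ∀ n : ℕ, 1 ≤ n → n ≤ N → ∀ i j : ℕ, 1 ≤ i → i ≤ M₁ - 1 → 1 ≤ j → j ≤ M₂ - 1 →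
    Δβ * (∑ l ∈ Finset.Icc 1 K,
        p l * (τ ^ (1 - β l) / Real.Gamma (3 - β l)) *
          (aCoef (β l) 0 * ((u n i j - u (n - 1) i j) / τ)
            - (∑ k ∈ Finset.Icc 1 (n - 1),
                (aCoef (β l) (n - k - 1) - aCoef (β l) (n - k)) *
                  ((u k i j - u (k - 1) i j) / τ))
            - aCoef (β l) (n - 1) * ψ₂ i j))
      + (1 / (4 * μ)) *
          deltaXSq h₁ (fun i' j' =>
            deltaYSq h₂ (fun a b => u n a b - u (n - 1) a b) i' j') i j
      = deltaXSq h₁ (fun a b => (u n a b + u (n - 1) a b) / 2) i j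
        + deltaYSq h₂ (fun a b => (u n a b + u (n - 1) a b) / 2) i j
        + f i j (((n : ℝ) - 1) * τ) (u (n - 1) i j)


/-! ### One dimensional tools -/

lemma sbp_aux (v w : ℕ → ℝ) (m : ℕ) :
    ∑ i ∈ Icc 1 m, (v (i + 1) - 2 * v i + v (i - 1)) * w i
      = -(∑ i ∈ range (m + 1), (v (i + 1) - v i) * (w (i + 1) - w i))
        + (v (m + 1) - v m) * w (m + 1) - (v 1 - v 0) * w 0 := by
  induction m with
  | zero => simp; ring
  | succ m ih =>
    rw [Finset.sum_Icc_succ_top (by omega), ih, Finset.sum_range_succ _ (m + 1)]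
    simp only [Nat.add_sub_cancel]
    ring

lemma sbp (v w : ℕ → ℝ) (M : ℕ) (hM : 1 ≤ M) (h0 : w 0 = 0) (h1 : w M = 0) :
    ∑ i ∈ Icc 1 (M - 1), (v (i + 1) - 2 * v i + v (i - 1)) * w i
      = -(∑ i ∈ range M, (v (i + 1) - v i) * (w (i + 1) - w i)) := by
  obtain ⟨m, rfl⟩ : ∃ m, M = m + 1 := ⟨M - 1, by omega⟩
  rw [Nat.add_sub_cancel, sbp_aux, h0, h1]
  ring

lemma poincare1 (v : ℕ → ℝ) (M : ℕ) (h0 : v 0 = 0) :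
    ∑ i ∈ Icc 1 (M - 1), (v i) ^ 2 ≤ (M : ℝ) ^ 2 * ∑ i ∈ range M, (v (i + 1) - v i) ^ 2 := by
  have key : ∀ i ∈ Icc 1 (M - 1), (v i) ^ 2 ≤ (M : ℝ) * ∑ i ∈ range M, (v (i + 1) - v i) ^ 2 := by
    intro i hi
    rw [Finset.mem_Icc] at hi
    have h1 : v i = ∑ k ∈ range i, (v (k + 1) - v k) := by
      rw [Finset.sum_range_sub, h0, sub_zero]
    have h2 : (∑ k ∈ range i, (v (k + 1) - v k)) ^ 2
        ≤ (i : ℝ) * ∑ k ∈ range i, (v (k + 1) - v k) ^ 2 := by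
      have := sq_sum_le_card_mul_sum_sq (s := range i) (f := fun k => v (k + 1) - v k)
      simpa using this
    rw [h1]
    refine h2.trans ?_
    have hiM : i ≤ M := by omega
    have h3 : ∑ k ∈ range i, (v (k + 1) - v k) ^ 2 ≤ ∑ k ∈ range M, (v (k + 1) - v k) ^ 2 :=
      Finset.sum_le_sum_of_subset_of_nonneg (Finset.range_mono hiM)
        (fun _ _ _ => sq_nonneg _)
    have h4 : (i : ℝ) ≤ M := by exact_mod_cast hiM
    have h5 : 0 ≤ ∑ k ∈ range i, (v (k + 1) - v k) ^ 2 := Finset.sum_nonneg (fun _ _ => sq_nonneg _)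
    exact mul_le_mul h4 h3 h5 (by positivity)
  have hs : 0 ≤ ∑ i ∈ range M, (v (i + 1) - v i) ^ 2 := Finset.sum_nonneg (fun _ _ => sq_nonneg _)
  calc _ ≤ ∑ i ∈ Icc 1 (M - 1), (M : ℝ) * ∑ i ∈ range M, (v (i + 1) - v i) ^ 2 :=
        Finset.sum_le_sum key
    _ = ((M - 1 : ℕ) : ℝ) * ((M : ℝ) * ∑ i ∈ range M, (v (i + 1) - v i) ^ 2) := by
        simp
    _ ≤ (M : ℝ) * ((M : ℝ) * ∑ i ∈ range M, (v (i + 1) - v i) ^ 2) := by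
        apply mul_le_mul_of_nonneg_right _ (by positivity)
        exact_mod_cast Nat.sub_le M 1
    _ = _ := by ring

/-! ### Two dimensional tools -/

/-- interior sum -/
noncomputable def iS (M₁ M₂ : ℕ) (v : ℕ → ℕ → ℝ) : ℝ :=
  ∑ i ∈ Icc 1 (M₁ - 1), ∑ j ∈ Icc 1 (M₂ - 1), v i j

/-- gradient form -/
noncomputable def gS (h₁ h₂ : ℝ) (M₁ M₂ : ℕ) (v w : ℕ → ℕ → ℝ) : ℝ :=
  (∑ j ∈ Icc 1 (M₂ - 1), ∑ i ∈ range M₁, (v (i + 1) j - v i j) * (w (i + 1) j - w i j)) / h₁ ^ 2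
  + (∑ i ∈ Icc 1 (M₁ - 1), ∑ j ∈ range M₂, (v i (j + 1) - v i j) * (w i (j + 1) - w i j)) / h₂ ^ 2

/-- zero boundary -/
def ZB (M₁ M₂ : ℕ) (w : ℕ → ℕ → ℝ) : Prop :=
  ∀ i j, i ≤ M₁ → j ≤ M₂ → (i = 0 ∨ i = M₁ ∨ j = 0 ∨ j = M₂) → w i j = 0

lemma iS_mono {M₁ M₂ : ℕ} {v w : ℕ → ℕ → ℝ}
    (h : ∀ i j, 1 ≤ i → i ≤ M₁ - 1 → 1 ≤ j → j ≤ M₂ - 1 → v i j ≤ w i j) :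
    iS M₁ M₂ v ≤ iS M₁ M₂ w := by
  unfold iS
  refine Finset.sum_le_sum (fun i hi => Finset.sum_le_sum (fun j hj => ?_))
  rw [Finset.mem_Icc] at hi hj
  exact h i j hi.1 hi.2 hj.1 hj.2

lemma iS_add (M₁ M₂ : ℕ) (v w : ℕ → ℕ → ℝ) :
    iS M₁ M₂ (fun i j => v i j + w i j) = iS M₁ M₂ v + iS M₁ M₂ w := by
  simp only [iS, Finset.sum_add_distrib]

lemma iS_sub (M₁ M₂ : ℕ) (v w : ℕ → ℕ → ℝ) :
    iS M₁ M₂ (fun i j => v i j - w i j) = iS M₁ M₂ v - iS M₁ M₂ w := by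
  simp only [iS, Finset.sum_sub_distrib]

lemma iS_smul (M₁ M₂ : ℕ) (c : ℝ) (v : ℕ → ℕ → ℝ) :
    iS M₁ M₂ (fun i j => c * v i j) = c * iS M₁ M₂ v := by
  simp only [iS, Finset.mul_sum]

lemma iS_sum (M₁ M₂ m : ℕ) (v : ℕ → ℕ → ℕ → ℝ) :
    iS M₁ M₂ (fun i j => ∑ r ∈ range m, v r i j) = ∑ r ∈ range m, iS M₁ M₂ (v r) := by
  induction m with
  | zero => simp [iS]
  | succ m ih => simp only [Finset.sum_range_succ, iS_add, ih]

lemma iS_sq_nonneg (M₁ M₂ : ℕ) (v : ℕ → ℕ → ℝ) : 0 ≤ iS M₁ M₂ (fun i j => v i j ^ 2) :=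
  Finset.sum_nonneg (fun _ _ => Finset.sum_nonneg (fun _ _ => sq_nonneg _))

lemma lap_sbp (h₁ h₂ : ℝ) (M₁ M₂ : ℕ) (hM₁ : 1 ≤ M₁) (hM₂ : 1 ≤ M₂) (v w : ℕ → ℕ → ℝ)
    (hw : ZB M₁ M₂ w) :
    iS M₁ M₂ (fun i j => (deltaXSq h₁ v i j + deltaYSq h₂ v i j) * w i j)
      = -gS h₁ h₂ M₁ M₂ v w := by
  simp only [add_mul]
  rw [iS_add]
  have e1 : iS M₁ M₂ (fun i j => deltaXSq h₁ v i j * w i j)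
      = -((∑ j ∈ Icc 1 (M₂ - 1), ∑ i ∈ range M₁,
          (v (i + 1) j - v i j) * (w (i + 1) j - w i j)) / h₁ ^ 2) := by
    unfold iS
    rw [Finset.sum_comm, Finset.sum_div, ← Finset.sum_neg_distrib]
    refine Finset.sum_congr rfl (fun j hj => ?_)
    rw [Finset.mem_Icc] at hj
    have := sbp (fun i => v i j) (fun i => w i j) M₁ hM₁
      (hw 0 j (by omega) (by omega) (by simp)) (hw M₁ j (by omega) (by omega) (by simp))
    rw [← neg_div, ← this, Finset.sum_div]
    refine Finset.sum_congr rfl (fun i _ => ?_)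
    unfold deltaXSq
    ring
  have e2 : iS M₁ M₂ (fun i j => deltaYSq h₂ v i j * w i j)
      = -((∑ i ∈ Icc 1 (M₁ - 1), ∑ j ∈ range M₂,
          (v i (j + 1) - v i j) * (w i (j + 1) - w i j)) / h₂ ^ 2) := by
    unfold iS
    rw [Finset.sum_div, ← Finset.sum_neg_distrib]
    refine Finset.sum_congr rfl (fun i hi => ?_)
    rw [Finset.mem_Icc] at hi
    have := sbp (fun j => v i j) (fun j => w i j) M₂ hM₂
      (hw i 0 (by omega) (by omega) (by simp)) (hw i M₂ (by omega) (by omega) (by simp))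
    rw [← neg_div, ← this, Finset.sum_div]
    refine Finset.sum_congr rfl (fun j _ => ?_)
    unfold deltaYSq
    ring
  rw [e1, e2, gS]
  ring

lemma cross_nonneg (h₁ h₂ : ℝ) (M₁ M₂ : ℕ) (hM₁ : 1 ≤ M₁) (hM₂ : 1 ≤ M₂) (w : ℕ → ℕ → ℝ)
    (hw : ZB M₁ M₂ w) :
    0 ≤ iS M₁ M₂ (fun i j => deltaXSq h₁ (fun i' j' => deltaYSq h₂ w i' j') i j * w i j) := by
  have e1 : iS M₁ M₂ (fun i j => deltaXSq h₁ (fun i' j' => deltaYSq h₂ w i' j') i j * w i j)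
      = -((∑ j ∈ Icc 1 (M₂ - 1), ∑ i ∈ range M₁,
          (deltaYSq h₂ w (i + 1) j - deltaYSq h₂ w i j) * (w (i + 1) j - w i j)) / h₁ ^ 2) := by
    unfold iS
    rw [Finset.sum_comm, Finset.sum_div, ← Finset.sum_neg_distrib]
    refine Finset.sum_congr rfl (fun j hj => ?_)
    rw [Finset.mem_Icc] at hj
    have := sbp (fun i => deltaYSq h₂ w i j) (fun i => w i j) M₁ hM₁
      (hw 0 j (by omega) (by omega) (by simp)) (hw M₁ j (by omega) (by omega) (by simp))
    rw [← neg_div, ← this, Finset.sum_div]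
    refine Finset.sum_congr rfl (fun i _ => ?_)
    unfold deltaXSq
    ring
  rw [e1, Finset.sum_comm, ← neg_div, ← Finset.sum_neg_distrib]
  refine div_nonneg (Finset.sum_nonneg (fun i hi => ?_)) (sq_nonneg _)
  rw [Finset.mem_range] at hi
  have := sbp (fun j => w (i + 1) j - w i j) (fun j => w (i + 1) j - w i j) M₂ hM₂
    (by
      show w (i + 1) _ - w i _ = 0
      rw [hw (i + 1) 0 (by omega) (by omega) (by simp), hw i 0 (by omega) (by omega) (by simp), sub_zero])
    (by
      show w (i + 1) _ - w i _ = 0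
      rw [hw (i + 1) M₂ (by omega) (by omega) (by simp), hw i M₂ (by omega) (by omega) (by simp), sub_zero])
  have e2 : ∑ j ∈ Icc 1 (M₂ - 1), (deltaYSq h₂ w (i + 1) j - deltaYSq h₂ w i j) * (w (i + 1) j - w i j)
     = -(∑ j ∈ range M₂, ((w (i + 1) (j + 1) - w i (j + 1)) - (w (i + 1) j - w i j)) *
        ((w (i + 1) (j + 1) - w i (j + 1)) - (w (i + 1) j - w i j))) / h₂ ^ 2 := by
    rw [← this, Finset.sum_div]
    refine Finset.sum_congr rfl (fun j _ => ?_)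
    unfold deltaYSq
    ring
  rw [e2, neg_div, neg_neg]
  exact div_nonneg (Finset.sum_nonneg (fun j _ => mul_self_nonneg _)) (sq_nonneg _)

lemma poincare2 (L₁ h₁ h₂ : ℝ) (M₁ M₂ : ℕ) (hM₁ : 1 ≤ M₁) (hL₁ : 0 < L₁)
    (hh₁ : h₁ = L₁ / M₁) (w : ℕ → ℕ → ℝ) (hw : ZB M₁ M₂ w) :
    iS M₁ M₂ (fun i j => w i j ^ 2) ≤ L₁ ^ 2 * gS h₁ h₂ M₁ M₂ w w := by
  have hMpos : (0 : ℝ) < M₁ := by exact_mod_cast hM₁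
  have h2 : 0 ≤ (∑ i ∈ Icc 1 (M₁ - 1), ∑ j ∈ range M₂,
      (w i (j + 1) - w i j) * (w i (j + 1) - w i j)) / h₂ ^ 2 :=
    div_nonneg (Finset.sum_nonneg (fun _ _ => Finset.sum_nonneg (fun j _ => mul_self_nonneg _)))
      (sq_nonneg _)
  have h1 : iS M₁ M₂ (fun i j => w i j ^ 2) ≤ L₁ ^ 2 * ((∑ j ∈ Icc 1 (M₂ - 1), ∑ i ∈ range M₁,
      (w (i + 1) j - w i j) * (w (i + 1) j - w i j)) / h₁ ^ 2) := by
    unfold iS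
    rw [Finset.sum_comm, Finset.sum_div, Finset.mul_sum]
    refine Finset.sum_le_sum (fun j hj => ?_)
    rw [Finset.mem_Icc] at hj
    refine (poincare1 (fun i => w i j) M₁ (hw 0 j (by omega) (by omega) (by simp))).trans
      (le_of_eq ?_)
    simp only [pow_two (_ - _)]
    rw [hh₁]
    field_simp
  unfold gS
  rw [mul_add]
  nlinarith [mul_nonneg (sq_nonneg L₁) h2]

lemma gS_self_nonneg (h₁ h₂ : ℝ) (M₁ M₂ : ℕ) (w : ℕ → ℕ → ℝ) : 0 ≤ gS h₁ h₂ M₁ M₂ w w :=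
  add_nonneg
    (div_nonneg (Finset.sum_nonneg (fun _ _ => Finset.sum_nonneg (fun _ _ => mul_self_nonneg _)))
      (sq_nonneg _))
    (div_nonneg (Finset.sum_nonneg (fun _ _ => Finset.sum_nonneg (fun _ _ => mul_self_nonneg _)))
      (sq_nonneg _))

lemma grad_le_lap (L₁ h₁ h₂ : ℝ) (M₁ M₂ : ℕ) (hM₁ : 1 ≤ M₁) (hM₂ : 1 ≤ M₂) (hL₁ : 0 < L₁)
    (hh₁ : h₁ = L₁ / M₁) (w : ℕ → ℕ → ℝ) (hw : ZB M₁ M₂ w) :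
    gS h₁ h₂ M₁ M₂ w w
      ≤ L₁ ^ 2 * iS M₁ M₂ (fun i j => (deltaXSq h₁ w i j + deltaYSq h₂ w i j) ^ 2) := by
  have hp := poincare2 L₁ h₁ h₂ M₁ M₂ hM₁ hL₁ hh₁ w hw
  have hs := lap_sbp h₁ h₂ M₁ M₂ hM₁ hM₂ w w hw
  have hL : 0 < L₁ ^ 2 := by positivity
  have hm : -(2 * iS M₁ M₂ (fun i j => (deltaXSq h₁ w i j + deltaYSq h₂ w i j) * w i j))
      ≤ L₁ ^ 2 * iS M₁ M₂ (fun i j => (deltaXSq h₁ w i j + deltaYSq h₂ w i j) ^ 2)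
        + (L₁ ^ 2)⁻¹ * iS M₁ M₂ (fun i j => w i j ^ 2) := by
    rw [← neg_mul, ← iS_smul, ← iS_smul, ← iS_smul, ← iS_add]
    refine iS_mono (fun i j _ _ _ _ => ?_)
    generalize deltaXSq h₁ w i j + deltaYSq h₂ w i j = a
    generalize w i j = b
    have : 0 ≤ (L₁ * a + L₁⁻¹ * b) ^ 2 := sq_nonneg _
    have e : (L₁ * a + L₁⁻¹ * b) ^ 2 = L₁ ^ 2 * a ^ 2 + (L₁ ^ 2)⁻¹ * b ^ 2 + 2 * (a * b) := by
      field_simp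
      ring
    linarith
  have h3 : (L₁ ^ 2)⁻¹ * iS M₁ M₂ (fun i j => w i j ^ 2) ≤ gS h₁ h₂ M₁ M₂ w w := by
    rw [inv_mul_le_iff₀ hL]
    exact hp
  rw [hs] at hm
  linarith

lemma gS_diff (h₁ h₂ τ : ℝ) (hτ : 0 < τ) (M₁ M₂ : ℕ) (v w : ℕ → ℕ → ℝ) :
    2 * gS h₁ h₂ M₁ M₂ (fun a b => (v a b + w a b) / 2) (fun a b => (v a b - w a b) / τ)
      = (gS h₁ h₂ M₁ M₂ v v - gS h₁ h₂ M₁ M₂ w w) / τ := by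
  unfold gS
  have e1 : ∑ j ∈ Icc 1 (M₂ - 1), ∑ i ∈ range M₁,
      ((v (i + 1) j + w (i + 1) j) / 2 - (v i j + w i j) / 2) *
        ((v (i + 1) j - w (i + 1) j) / τ - (v i j - w i j) / τ)
      = (∑ j ∈ Icc 1 (M₂ - 1), ∑ i ∈ range M₁, (v (i + 1) j - v i j) * (v (i + 1) j - v i j)
        - ∑ j ∈ Icc 1 (M₂ - 1), ∑ i ∈ range M₁, (w (i + 1) j - w i j) * (w (i + 1) j - w i j))
         / (2 * τ) := by
    rw [← Finset.sum_sub_distrib, Finset.sum_div]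
    refine Finset.sum_congr rfl (fun j _ => ?_)
    rw [← Finset.sum_sub_distrib, Finset.sum_div]
    refine Finset.sum_congr rfl (fun i _ => ?_)
    field_simp
    ring
  have e2 : ∑ i ∈ Icc 1 (M₁ - 1), ∑ j ∈ range M₂,
      ((v i (j + 1) + w i (j + 1)) / 2 - (v i j + w i j) / 2) *
        ((v i (j + 1) - w i (j + 1)) / τ - (v i j - w i j) / τ)
      = (∑ i ∈ Icc 1 (M₁ - 1), ∑ j ∈ range M₂, (v i (j + 1) - v i j) * (v i (j + 1) - v i j)
        - ∑ i ∈ Icc 1 (M₁ - 1), ∑ j ∈ range M₂, (w i (j + 1) - w i j) * (w i (j + 1) - w i j))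
         / (2 * τ) := by
    rw [← Finset.sum_sub_distrib, Finset.sum_div]
    refine Finset.sum_congr rfl (fun j _ => ?_)
    rw [← Finset.sum_sub_distrib, Finset.sum_div]
    refine Finset.sum_congr rfl (fun i _ => ?_)
    field_simp
    ring
  rw [e1, e2]
  ring

/-! ### Coefficients -/

lemma aCoef_anti (β : ℝ) (h1 : 1 < β) (h2 : β < 2) (k : ℕ) : aCoef β (k + 1) ≤ aCoef β k := by
  have hc := Real.concaveOn_rpow (p := 2 - β) (by linarith) (by linarith)
  have hk : (0 : ℝ) ≤ k := by positivity
  have hk2 : (k : ℝ) + 2 ∈ Set.Ici (0 : ℝ) := by simp only [Set.mem_Ici]; linarith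
  have := hc.2 (Set.mem_Ici.2 hk) hk2 (show (0 : ℝ) ≤ 1 / 2 by norm_num)
    (show (0 : ℝ) ≤ 1 / 2 by norm_num) (by norm_num)
  simp only [smul_eq_mul] at this
  have e : (1 / 2 * (k : ℝ) + 1 / 2 * (k + 2)) = k + 1 := by ring
  rw [e] at this
  unfold aCoef
  push_cast
  rw [show (k : ℝ) + 1 + 1 = k + 2 by ring]
  linarith

lemma aCoef_lower (β : ℝ) (h1 : 1 < β) (h2 : β < 2) (k : ℕ) :
    (2 - β) * ((k : ℝ) + 1) ^ (1 - β) ≤ aCoef β k := by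
  have hx : (0 : ℝ) < (k : ℝ) + 1 := by positivity
  have hb := rpow_one_add_le_one_add_mul_self (s := -(1 / ((k : ℝ) + 1))) (p := 2 - β)
    (by rw [neg_le_neg_iff, div_le_one hx]; have : (0 : ℝ) ≤ k := by positivity
        linarith) (by linarith) (by linarith)
  have e : (k : ℝ) = (k + 1) * (1 + -(1 / ((k : ℝ) + 1))) := by field_simp; ring
  have hnn : 0 ≤ 1 + -(1 / ((k : ℝ) + 1)) := by
    rw [← sub_eq_add_neg, sub_nonneg, div_le_one hx]
    have : (0 : ℝ) ≤ k := by positivity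
    linarith
  have e2 : (k : ℝ) ^ (2 - β) = (k + 1 : ℝ) ^ (2 - β) * (1 + -(1 / ((k : ℝ) + 1))) ^ (2 - β) := by
    rw [← Real.mul_rpow hx.le hnn, ← e]
  have e3 : ((k : ℝ) + 1) ^ (1 - β) = ((k : ℝ) + 1) ^ (2 - β) / (k + 1) := by
    rw [show 1 - β = (2 - β) - 1 by ring, Real.rpow_sub_one hx.ne']
  unfold aCoef
  rw [e2, e3]
  have hpos : 0 < ((k : ℝ) + 1) ^ (2 - β) := by positivity
  have := mul_le_mul_of_nonneg_left hb hpos.le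
  have e4 : ((k : ℝ) + 1) ^ (2 - β) * (1 + (2 - β) * -(1 / ((k : ℝ) + 1)))
     = ((k : ℝ) + 1) ^ (2 - β) - (2 - β) * (((k : ℝ) + 1) ^ (2 - β) / (k + 1)) := by ring
  linarith

lemma aCoef_sum (β : ℝ) (h2 : β < 2) (n : ℕ) : ∑ k ∈ range n, aCoef β k = (n : ℝ) ^ (2 - β) := by
  have := Finset.sum_range_sub (fun k : ℕ => (k : ℝ) ^ (2 - β)) n
  simp only [Nat.cast_add, Nat.cast_one, Nat.cast_zero] at this
  rw [Real.zero_rpow (by linarith), sub_zero] at this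
  exact this

/-- total weights -/
noncomputable def AA (K : ℕ) (Δβ τ : ℝ) (β p : ℕ → ℝ) (k : ℕ) : ℝ :=
  Δβ * ∑ l ∈ Icc 1 K, p l * (τ ^ (1 - β l) / Real.Gamma (3 - β l)) * aCoef (β l) k

/-! ### Time stepping -/

lemma tele (A : ℕ → ℝ) (m : ℕ) :
    ∑ r ∈ range m, (A (m - 1 - r) - A (m - r)) = A 0 - A m := by
  induction m with
  | zero => simp
  | succ m ih =>
    rw [Finset.sum_range_succ']
    have : ∑ k ∈ range m, (A (m + 1 - 1 - (k + 1)) - A (m + 1 - (k + 1))) = A 0 - A m := by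
      rw [← ih]
      refine Finset.sum_congr rfl (fun r hr => ?_)
      rw [show m + 1 - 1 - (r + 1) = m - 1 - r by omega, show m + 1 - (r + 1) = m - r by omega]
    rw [this]
    simp

lemma young_time (A d : ℕ → ℝ) (ψ x : ℝ) (m : ℕ) (hA : ∀ k, A (k + 1) ≤ A k) (hA0 : ∀ k, 0 ≤ A k) :
    A 0 * x ^ 2 - ∑ r ∈ range m, (A (m - 1 - r) - A (m - r)) * d r ^ 2 - A m * ψ ^ 2
      ≤ 2 * ((A 0 * x - ∑ r ∈ range m, (A (m - 1 - r) - A (m - r)) * d r - A m * ψ) * x) := by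
  have ht := tele A m
  have h1 : 2 * (∑ r ∈ range m, (A (m - 1 - r) - A (m - r)) * d r) * x
      ≤ ∑ r ∈ range m, (A (m - 1 - r) - A (m - r)) * d r ^ 2
        + (∑ r ∈ range m, (A (m - 1 - r) - A (m - r))) * x ^ 2 := by
    rw [Finset.sum_mul, ← Finset.sum_add_distrib, Finset.mul_sum, Finset.sum_mul]
    refine Finset.sum_le_sum (fun r hr => ?_)
    rw [Finset.mem_range] at hr
    have : 0 ≤ A (m - 1 - r) - A (m - r) := by
      have := hA (m - 1 - r)
      rw [show m - 1 - r + 1 = m - r by omega] at this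
      linarith
    nlinarith [mul_nonneg this (sq_nonneg (d r - x))]
  rw [ht] at h1
  nlinarith [mul_nonneg (hA0 m) (sq_nonneg (ψ - x))]

lemma gronwall (x : ℕ → ℝ) (B c : ℝ) (N : ℕ) (hc : 0 ≤ c) 
    (h : ∀ n ≤ N, x n ≤ B + c * ∑ k ∈ range n, x k) :
    ∀ n ≤ N, x n ≤ B * (1 + c) ^ n := by
  have key : ∀ n ≤ N, B + c * ∑ k ∈ range n, x k ≤ B * (1 + c) ^ n := by
    intro n
    induction n with
    | zero => intro _; simp
    | succ n ih =>
      intro hn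
      have h1 := ih (by omega)
      have h2 := h n (by omega)
      rw [Finset.sum_range_succ, pow_succ]
      nlinarith
  intro n hn
  exact (h n hn).trans (key n hn)

lemma time_energy (A Y X P : ℕ → ℝ) (τ Ψ c0 κ : ℝ) (N : ℕ) (hτ : 0 < τ)
    (hY : ∀ k, 0 ≤ Y k) (hc : ∀ k < N, c0 ≤ A k)
    (h : ∀ m < N, A 0 * Y m - ∑ r ∈ range m, (A (m - 1 - r) - A (m - r)) * Y r - A m * Ψ
      + (P (m + 1) - P m) / τ ≤ c0 * Y m + κ * X m) :
    ∀ n ≤ N, P n ≤ P 0 + τ * (∑ k ∈ range n, A k) * Ψ + τ * κ * ∑ k ∈ range n, X k := by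
  have key : ∀ n ≤ N, τ * (∑ r ∈ range n, A (n - 1 - r) * Y r) + P n
      ≤ P 0 + τ * (∑ k ∈ range n, A k) * Ψ + τ * κ * ∑ k ∈ range n, X k
        + τ * c0 * ∑ k ∈ range n, Y k := by
    intro n
    induction n with
    | zero => intro _; simp
    | succ n ih =>
      intro hn
      have h1 := ih (by omega)
      have h2 := h n (by omega)
      have h3 : ∑ r ∈ range (n + 1), A (n + 1 - 1 - r) * Y r
          = A 0 * Y n + ∑ r ∈ range n, A (n - r) * Y r := by
        rw [Finset.sum_range_succ]
        simp [add_comm]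
      have h4 : ∑ r ∈ range n, (A (n - 1 - r) - A (n - r)) * Y r
          = ∑ r ∈ range n, A (n - 1 - r) * Y r - ∑ r ∈ range n, A (n - r) * Y r := by
        rw [← Finset.sum_sub_distrib]
        exact Finset.sum_congr rfl (fun r _ => by ring)
      rw [h4] at h2
      have h5 := mul_le_mul_of_nonneg_left h2 hτ.le
      have h6 : τ * ((P (n + 1) - P n) / τ) = P (n + 1) - P n := by field_simp
      rw [mul_add, h6] at h5
      rw [h3, Finset.sum_range_succ, Finset.sum_range_succ, Finset.sum_range_succ]
      nlinarith
  intro n hn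
  have h1 := key n hn
  have h2 : c0 * ∑ k ∈ range n, Y k ≤ ∑ r ∈ range n, A (n - 1 - r) * Y r := by
    rw [Finset.mul_sum]
    refine Finset.sum_le_sum (fun r hr => ?_)
    rw [Finset.mem_range] at hr
    exact mul_le_mul_of_nonneg_right (hc _ (by omega)) (hY r)
  nlinarith [mul_le_mul_of_nonneg_left h2 hτ.le]

lemma lhs_rewrite (K : ℕ) (Δβ τ : ℝ) (β p : ℕ → ℝ) (D : ℕ → ℝ) (ψ : ℝ) (m : ℕ) :
    Δβ * (∑ l ∈ Finset.Icc 1 K,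
        p l * (τ ^ (1 - β l) / Real.Gamma (3 - β l)) *
          (aCoef (β l) 0 * D (m + 1)
            - (∑ k ∈ Finset.Icc 1 (m + 1 - 1),
                (aCoef (β l) (m + 1 - k - 1) - aCoef (β l) (m + 1 - k)) * D k)
            - aCoef (β l) (m + 1 - 1) * ψ))
      = AA K Δβ τ β p 0 * D (m + 1)
        - ∑ r ∈ range m, (AA K Δβ τ β p (m - 1 - r) - AA K Δβ τ β p (m - r)) * D (r + 1)
        - AA K Δβ τ β p m * ψ := by
  have e : ∀ l, ∑ k ∈ Finset.Icc 1 (m + 1 - 1),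
                (aCoef (β l) (m + 1 - k - 1) - aCoef (β l) (m + 1 - k)) * D k
      = ∑ r ∈ range m, (aCoef (β l) (m - 1 - r) - aCoef (β l) (m - r)) * D (r + 1) := by
    intro l
    rw [Nat.add_sub_cancel, ← Finset.Ico_add_one_right_eq_Icc, Finset.sum_Ico_eq_sum_range]
    refine Finset.sum_congr rfl (fun r hr => ?_)
    rw [show m + 1 - (1 + r) - 1 = m - 1 - r by omega, show m + 1 - (1 + r) = m - r by omega,
      add_comm 1 r]
  simp only [e]
  simp only [Nat.add_sub_cancel]
  have e2 : ∑ r ∈ range m, (AA K Δβ τ β p (m - 1 - r) - AA K Δβ τ β p (m - r)) * D (r + 1)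
      = Δβ * ∑ l ∈ Icc 1 K, p l * (τ ^ (1 - β l) / Real.Gamma (3 - β l)) *
        ∑ r ∈ range m, (aCoef (β l) (m - 1 - r) - aCoef (β l) (m - r)) * D (r + 1) := by
    simp only [Finset.mul_sum]
    rw [Finset.sum_comm]
    refine Finset.sum_congr rfl (fun r _ => ?_)
    unfold AA
    rw [← mul_sub, ← Finset.sum_sub_distrib, Finset.mul_sum, Finset.sum_mul]
    refine Finset.sum_congr rfl (fun l _ => ?_)
    ring
  rw [e2]
  unfold AA
  simp only [mul_sub, Finset.sum_sub_distrib]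
  rw [mul_assoc Δβ, mul_assoc Δβ, Finset.sum_mul, Finset.sum_mul]
  simp only [mul_assoc]

lemma point_eq (M₁ M₂ N K : ℕ) (h₁ h₂ τ Δβ μ : ℝ) (β p : ℕ → ℝ) (hτ : 0 < τ)
    (f : ℕ → ℕ → ℝ → ℝ → ℝ) (u ut : ℕ → ℕ → ℕ → ℝ) (ψ₂ ψ₂t : ℕ → ℕ → ℝ)
    (hu : SatisfiesScheme M₁ M₂ N K h₁ h₂ τ Δβ μ β p f u ψ₂)
    (hut : SatisfiesScheme M₁ M₂ N K h₁ h₂ τ Δβ μ β p f ut ψ₂t)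
    (e d : ℕ → ℕ → ℕ → ℝ) (he : ∀ n i j, e n i j = u n i j - ut n i j)
    (hd : ∀ n i j, d n i j = (e (n + 1) i j - e n i j) / τ)
    (m : ℕ) (hm : m < N) (i j : ℕ) (hi : 1 ≤ i) (hi' : i ≤ M₁ - 1) (hj : 1 ≤ j) (hj' : j ≤ M₂ - 1) :
    (AA K Δβ τ β p 0 * d m i j
        - ∑ r ∈ range m, (AA K Δβ τ β p (m - 1 - r) - AA K Δβ τ β p (m - r)) * d r i j
        - AA K Δβ τ β p m * (ψ₂ i j - ψ₂t i j))
      + (1 / (4 * μ)) * (τ * deltaXSq h₁ (fun i' j' => deltaYSq h₂ (d m) i' j') i j)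
      = deltaXSq h₁ (fun a b => (e (m + 1) a b + e m a b) / 2) i j
        + deltaYSq h₂ (fun a b => (e (m + 1) a b + e m a b) / 2) i j
        + (f i j (((m + 1 : ℕ) - 1 : ℝ) * τ) (u m i j) - f i j (((m + 1 : ℕ) - 1 : ℝ) * τ) (ut m i j)) := by
  have E1 := hu (m + 1) (by omega) (by omega) i j hi hi' hj hj'
  have E2 := hut (m + 1) (by omega) (by omega) i j hi hi' hj hj'
  rw [lhs_rewrite K Δβ τ β p (fun k => (u k i j - u (k - 1) i j) / τ)] at E1
  rw [lhs_rewrite K Δβ τ β p (fun k => (ut k i j - ut (k - 1) i j) / τ)] at E2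
  simp only [Nat.add_sub_cancel] at E1 E2
  have s : ∑ r ∈ range m, (AA K Δβ τ β p (m - 1 - r) - AA K Δβ τ β p (m - r)) * d r i j
      = ∑ r ∈ range m, (AA K Δβ τ β p (m - 1 - r) - AA K Δβ τ β p (m - r)) *
          ((u (r + 1) i j - u r i j) / τ)
        - ∑ r ∈ range m, (AA K Δβ τ β p (m - 1 - r) - AA K Δβ τ β p (m - r)) *
          ((ut (r + 1) i j - ut r i j) / τ) := by
    rw [← Finset.sum_sub_distrib]
    refine Finset.sum_congr rfl (fun r _ => ?_)
    rw [hd, he, he]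
    ring
  have x1 : τ * deltaXSq h₁ (fun i' j' => deltaYSq h₂ (d m) i' j') i j
      = deltaXSq h₁ (fun i' j' => deltaYSq h₂ (fun a b => u (m + 1) a b - u m a b) i' j') i j
       - deltaXSq h₁ (fun i' j' => deltaYSq h₂ (fun a b => ut (m + 1) a b - ut m a b) i' j') i j := by
    have q : ∀ a b, u (m + 1) a b - u m a b = (ut (m + 1) a b - ut m a b) + τ * d m a b := by
      intro a b
      rw [hd, he, he, mul_div_cancel₀ _ hτ.ne']
      ring
    simp only [deltaXSq, deltaYSq, q]
    ring
  have x2 : deltaXSq h₁ (fun a b => (e (m + 1) a b + e m a b) / 2) i j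
     = deltaXSq h₁ (fun a b => (u (m + 1) a b + u m a b) / 2) i j
      - deltaXSq h₁ (fun a b => (ut (m + 1) a b + ut m a b) / 2) i j := by
    simp only [deltaXSq, he]
    ring
  have x3 : deltaYSq h₂ (fun a b => (e (m + 1) a b + e m a b) / 2) i j
     = deltaYSq h₂ (fun a b => (u (m + 1) a b + u m a b) / 2) i j
      - deltaYSq h₂ (fun a b => (ut (m + 1) a b + ut m a b) / 2) i j := by
    simp only [deltaYSq, he]
    ring
  have x4 : d m i j = (u (m + 1) i j - u m i j) / τ - (ut (m + 1) i j - ut m i j) / τ := by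
    rw [hd, he, he]
    ring
  rw [s, x1, x2, x3, x4]
  linear_combination E1 - E2

lemma step_ineq (M₁ M₂ : ℕ) (hM₁ : 1 ≤ M₁) (hM₂ : 1 ≤ M₂) (h₁ h₂ τ μ Lf c0 : ℝ)
    (hτ : 0 < τ) (hμ : 0 < μ) (hc0 : 0 < c0)
    (A : ℕ → ℝ) (hA : ∀ k, A (k + 1) ≤ A k) (hA0 : ∀ k, 0 ≤ A k)
    (e d : ℕ → ℕ → ℕ → ℝ) (ψ g : ℕ → ℕ → ℝ)
    (hd : ∀ n i j, d n i j = (e (n + 1) i j - e n i j) / τ) (m : ℕ)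
    (hz : ZB M₁ M₂ (e m)) (hz' : ZB M₁ M₂ (e (m + 1)))
    (hg : ∀ i j, 1 ≤ i → i ≤ M₁ - 1 → 1 ≤ j → j ≤ M₂ - 1 → |g i j| ≤ Lf * |e m i j|)
    (heq : ∀ i j, 1 ≤ i → i ≤ M₁ - 1 → 1 ≤ j → j ≤ M₂ - 1 →
      (A 0 * d m i j - ∑ r ∈ range m, (A (m - 1 - r) - A (m - r)) * d r i j - A m * ψ i j)
      + (1 / (4 * μ)) * (τ * deltaXSq h₁ (fun i' j' => deltaYSq h₂ (d m) i' j') i j)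
      = deltaXSq h₁ (fun a b => (e (m + 1) a b + e m a b) / 2) i j
        + deltaYSq h₂ (fun a b => (e (m + 1) a b + e m a b) / 2) i j + g i j) :
    A 0 * iS M₁ M₂ (fun i j => d m i j ^ 2)
      - ∑ r ∈ range m, (A (m - 1 - r) - A (m - r)) * iS M₁ M₂ (fun i j => d r i j ^ 2)
      - A m * iS M₁ M₂ (fun i j => ψ i j ^ 2)
      + (gS h₁ h₂ M₁ M₂ (e (m + 1)) (e (m + 1)) - gS h₁ h₂ M₁ M₂ (e m) (e m)) / τ
    ≤ c0 * iS M₁ M₂ (fun i j => d m i j ^ 2)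
      + (Lf ^ 2 / c0) * iS M₁ M₂ (fun i j => e m i j ^ 2) := by
  have hzd : ZB M₁ M₂ (d m) := by
    intro i j hi hj hb
    rw [hd, hz i j hi hj hb, hz' i j hi hj hb]
    simp
  have hcross := cross_nonneg h₁ h₂ M₁ M₂ hM₁ hM₂ (d m) hzd
  have hlap := lap_sbp h₁ h₂ M₁ M₂ hM₁ hM₂ (fun a b => (e (m + 1) a b + e m a b) / 2) (d m) hzd
  have hdm : d m = fun a b => (e (m + 1) a b - e m a b) / τ := by
    funext a b
    exact hd m a b
  have hgd := gS_diff h₁ h₂ τ hτ M₁ M₂ (e (m + 1)) (e m)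
  rw [← hdm] at hgd
  have main : iS M₁ M₂ (fun i j => (A 0 * d m i j ^ 2
        - ∑ r ∈ range m, (A (m - 1 - r) - A (m - r)) * d r i j ^ 2) - A m * ψ i j ^ 2)
      ≤ iS M₁ M₂ (fun i j =>
          (2 * ((deltaXSq h₁ (fun a b => (e (m + 1) a b + e m a b) / 2) i j
            + deltaYSq h₂ (fun a b => (e (m + 1) a b + e m a b) / 2) i j) * d m i j)
          - (2 * (1 / (4 * μ)) * τ) *
            (deltaXSq h₁ (fun i' j' => deltaYSq h₂ (d m) i' j') i j * d m i j))
          + (c0 * d m i j ^ 2 + (Lf ^ 2 / c0) * e m i j ^ 2)) := by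
    refine iS_mono (fun i j hi hi' hj hj' => ?_)
    have hy := young_time A (fun r => d r i j) (ψ i j) (d m i j) m hA hA0
    have hq := heq i j hi hi' hj hj'
    have hg' := hg i j hi hi' hj hj'
    have hg2 : g i j ^ 2 ≤ Lf ^ 2 * e m i j ^ 2 := by
      rw [← sq_abs (g i j), ← sq_abs (e m i j), ← mul_pow]
      exact pow_le_pow_left₀ (abs_nonneg _) hg' 2
    have hyg : 2 * (g i j * d m i j) ≤ c0 * d m i j ^ 2 + (Lf ^ 2 / c0) * e m i j ^ 2 := by
      have h3 : 2 * (g i j * d m i j) ≤ c0 * d m i j ^ 2 + g i j ^ 2 / c0 := by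
        have : c0 * d m i j ^ 2 + g i j ^ 2 / c0 - 2 * (g i j * d m i j)
            = (c0 * d m i j - g i j) ^ 2 / c0 := by
          field_simp
          ring
        have h4 : 0 ≤ (c0 * d m i j - g i j) ^ 2 / c0 := by positivity
        linarith
      have h5 : g i j ^ 2 / c0 ≤ (Lf ^ 2 / c0) * e m i j ^ 2 := by
        rw [div_mul_eq_mul_div]
        exact div_le_div_of_nonneg_right hg2 hc0.le
      linarith
    rw [eq_sub_of_add_eq hq] at hy
    linarith
  rw [iS_sub, iS_sub, iS_smul, iS_smul, iS_sum, iS_add, iS_sub, iS_add, iS_smul, iS_smul, iS_smul,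
    iS_smul, hlap] at main
  simp only [iS_smul] at main
  have hk : 0 ≤ (2 * (1 / (4 * μ)) * τ) *
     iS M₁ M₂ (fun i j => deltaXSq h₁ (fun i' j' => deltaYSq h₂ (d m) i' j') i j * d m i j) :=
    mul_nonneg (by positivity) hcross
  linarith

lemma AA_anti (K : ℕ) (Δβ τ : ℝ) (β p : ℕ → ℝ) (hΔβ : 0 < Δβ) (hτ : 0 < τ)
    (hβ : ∀ l ∈ Finset.Icc 1 K, 1 < β l ∧ β l < 2) (hp : ∀ l ∈ Finset.Icc 1 K, 0 < p l) (k : ℕ) :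
    AA K Δβ τ β p (k + 1) ≤ AA K Δβ τ β p k := by
  unfold AA
  refine mul_le_mul_of_nonneg_left (Finset.sum_le_sum (fun l hl => ?_)) hΔβ.le
  have hb := hβ l hl
  have := hp l hl
  have hG : 0 < Real.Gamma (3 - β l) := Real.Gamma_pos_of_pos (by linarith)
  exact mul_le_mul_of_nonneg_left (aCoef_anti _ hb.1 hb.2 k) (by positivity)

lemma AA_nonneg (K : ℕ) (Δβ τ : ℝ) (β p : ℕ → ℝ) (hΔβ : 0 < Δβ) (hτ : 0 < τ)
    (hβ : ∀ l ∈ Finset.Icc 1 K, 1 < β l ∧ β l < 2) (hp : ∀ l ∈ Finset.Icc 1 K, 0 < p l) (k : ℕ) :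
    0 ≤ AA K Δβ τ β p k := by
  unfold AA
  refine mul_nonneg hΔβ.le (Finset.sum_nonneg (fun l hl => ?_))
  have hb := hβ l hl
  have := hp l hl
  have hG : 0 < Real.Gamma (3 - β l) := Real.Gamma_pos_of_pos (by linarith)
  have ha := aCoef_lower _ hb.1 hb.2 k
  have h2 : 0 ≤ (2 - β l) * ((k : ℝ) + 1) ^ (1 - β l) := mul_nonneg (by linarith) (by positivity)
  exact mul_nonneg (by positivity) (h2.trans ha)

/-- lower bound of weights -/
noncomputable def cLow (K : ℕ) (Δβ T : ℝ) (β p : ℕ → ℝ) : ℝ :=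
  Δβ * ∑ l ∈ Icc 1 K, p l * (T ^ (1 - β l) / Real.Gamma (3 - β l)) * (2 - β l)

/-- upper bound of the weight sum -/
noncomputable def cUp (K : ℕ) (Δβ T : ℝ) (β p : ℕ → ℝ) : ℝ :=
  Δβ * ∑ l ∈ Icc 1 K, p l * (T ^ (2 - β l) / Real.Gamma (3 - β l))

lemma cLow_pos (K : ℕ) (hK : 1 ≤ K) (Δβ T : ℝ) (β p : ℕ → ℝ) (hΔβ : 0 < Δβ) (hT : 0 < T)
    (hβ : ∀ l ∈ Finset.Icc 1 K, 1 < β l ∧ β l < 2) (hp : ∀ l ∈ Finset.Icc 1 K, 0 < p l) :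
    0 < cLow K Δβ T β p := by
  refine mul_pos hΔβ (Finset.sum_pos (fun l hl => ?_) ⟨1, by simp [hK]⟩)
  have hb := hβ l hl
  have := hp l hl
  have hG : 0 < Real.Gamma (3 - β l) := Real.Gamma_pos_of_pos (by linarith)
  exact mul_pos (by positivity) (by linarith)

lemma cUp_pos (K : ℕ) (hK : 1 ≤ K) (Δβ T : ℝ) (β p : ℕ → ℝ) (hΔβ : 0 < Δβ) (hT : 0 < T)
    (hβ : ∀ l ∈ Finset.Icc 1 K, 1 < β l ∧ β l < 2) (hp : ∀ l ∈ Finset.Icc 1 K, 0 < p l) :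
    0 < cUp K Δβ T β p := by
  refine mul_pos hΔβ (Finset.sum_pos (fun l hl => ?_) ⟨1, by simp [hK]⟩)
  have hb := hβ l hl
  have := hp l hl
  have hG : 0 < Real.Gamma (3 - β l) := Real.Gamma_pos_of_pos (by linarith)
  positivity

lemma AA_lower (K N : ℕ) (Δβ τ T : ℝ) (β p : ℕ → ℝ) (hΔβ : 0 < Δβ) (hτ : 0 < τ)
    (hT : T = N * τ)
    (hβ : ∀ l ∈ Finset.Icc 1 K, 1 < β l ∧ β l < 2) (hp : ∀ l ∈ Finset.Icc 1 K, 0 < p l) (k : ℕ)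
    (hk : k < N) : cLow K Δβ T β p ≤ AA K Δβ τ β p k := by
  unfold AA cLow
  refine mul_le_mul_of_nonneg_left (Finset.sum_le_sum (fun l hl => ?_)) hΔβ.le
  have hb := hβ l hl
  have := hp l hl
  have hG : 0 < Real.Gamma (3 - β l) := Real.Gamma_pos_of_pos (by linarith)
  have ha := aCoef_lower _ hb.1 hb.2 k
  have hkN : (k : ℝ) + 1 ≤ N := by exact_mod_cast hk
  have h1 : (N : ℝ) ^ (1 - β l) ≤ ((k : ℝ) + 1) ^ (1 - β l) :=
    Real.rpow_le_rpow_of_nonpos (by positivity) hkN (by linarith)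
  have h2 : (2 - β l) * (N : ℝ) ^ (1 - β l) ≤ aCoef (β l) k :=
    (mul_le_mul_of_nonneg_left h1 (by linarith)).trans ha
  rw [hT, Real.mul_rpow (by positivity) hτ.le]
  calc _ = p l * (τ ^ (1 - β l) / Real.Gamma (3 - β l)) * ((2 - β l) * (N : ℝ) ^ (1 - β l)) := by ring
    _ ≤ _ := mul_le_mul_of_nonneg_left h2 (by positivity)

lemma AA_sum (K N : ℕ) (Δβ τ T : ℝ) (β p : ℕ → ℝ) (hΔβ : 0 < Δβ) (hτ : 0 < τ)
    (hT : T = N * τ)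
    (hβ : ∀ l ∈ Finset.Icc 1 K, 1 < β l ∧ β l < 2) (hp : ∀ l ∈ Finset.Icc 1 K, 0 < p l) (n : ℕ)
    (hn : n ≤ N) : τ * ∑ k ∈ range n, AA K Δβ τ β p k ≤ cUp K Δβ T β p := by
  unfold AA cUp
  rw [← Finset.mul_sum, Finset.sum_comm, mul_left_comm, Finset.mul_sum]
  refine mul_le_mul_of_nonneg_left (Finset.sum_le_sum (fun l hl => ?_)) hΔβ.le
  have hb := hβ l hl
  have := hp l hl
  have hG : 0 < Real.Gamma (3 - β l) := Real.Gamma_pos_of_pos (by linarith)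
  rw [← Finset.mul_sum, aCoef_sum _ hb.2]
  have hnN : (n : ℝ) ≤ N := by exact_mod_cast hn
  have h1 : (n : ℝ) ^ (2 - β l) ≤ (N : ℝ) ^ (2 - β l) :=
    Real.rpow_le_rpow (by positivity) hnN (by linarith)
  have h2 : τ ^ (2 - β l) = τ * τ ^ (1 - β l) := by
    rw [show 2 - β l = 1 + (1 - β l) by ring, Real.rpow_add hτ, Real.rpow_one]
  rw [hT, Real.mul_rpow (by positivity) hτ.le, h2]
  calc _ = p l * (τ * τ ^ (1 - β l) / Real.Gamma (3 - β l)) * (n : ℝ) ^ (2 - β l) := by ring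
    _ ≤ p l * (τ * τ ^ (1 - β l) / Real.Gamma (3 - β l)) * (N : ℝ) ^ (2 - β l) :=
      mul_le_mul_of_nonneg_left h1 (by positivity)
    _ = _ := by ring

theorem stmt_14 (T L₁ L₂ Lf : ℝ) (hT : 0 < T) (hL₁ : 0 < L₁) (hL₂ : 0 < L₂) (hLf : 0 < Lf)
    (K : ℕ) (hK : 1 ≤ K) (Δβ : ℝ) (hΔβ : 0 < Δβ) (β p : ℕ → ℝ)
    (hβ : ∀ l ∈ Finset.Icc 1 K, 1 < β l ∧ β l < 2)
    (hp : ∀ l ∈ Finset.Icc 1 K, 0 < p l) :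
    ∃ C : ℝ, 0 < C ∧
      ∀ (N M₁ M₂ : ℕ), 1 ≤ N → 2 ≤ M₁ → 2 ≤ M₂ →
      ∀ (τ h₁ h₂ μ : ℝ), τ = T / N → h₁ = L₁ / M₁ → h₂ = L₂ / M₂ →
        μ = Δβ * ∑ l ∈ Finset.Icc 1 K, p l * (τ ^ (-(β l)) / Real.Gamma (3 - β l)) →
      ∀ f : ℕ → ℕ → ℝ → ℝ → ℝ,
        (∀ i j : ℕ, 1 ≤ i → i ≤ M₁ - 1 → 1 ≤ j → j ≤ M₂ - 1 →
          ∀ t u₁ u₂ : ℝ, |f i j t u₁ - f i j t u₂| ≤ Lf * |u₁ - u₂|) →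
      ∀ (u ut : ℕ → ℕ → ℕ → ℝ) (ψ₂ ψ₂t : ℕ → ℕ → ℝ),
        (∀ n ≤ N, ∀ i j : ℕ, i ≤ M₁ → j ≤ M₂ →
          (i = 0 ∨ i = M₁ ∨ j = 0 ∨ j = M₂) → u n i j = ut n i j) →
        SatisfiesScheme M₁ M₂ N K h₁ h₂ τ Δβ μ β p f u ψ₂ →
        SatisfiesScheme M₁ M₂ N K h₁ h₂ τ Δβ μ β p f ut ψ₂t →
        ∀ n : ℕ, 1 ≤ n → n ≤ N →
          gridNormSq h₁ h₂ M₁ M₂ (fun i j => u n i j - ut n i j)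
            ≤ C * (lapNormSq h₁ h₂ M₁ M₂ (fun i j => u 0 i j - ut 0 i j)
                + gridNormSq h₁ h₂ M₁ M₂ (fun i j => ψ₂ i j - ψ₂t i j)) := by
  have hc0 := cLow_pos K hK Δβ T β p hΔβ hT hβ hp
  have hc1 := cUp_pos K hK Δβ T β p hΔβ hT hβ hp
  set c0 := cLow K Δβ T β p with hc0def
  set c1 := cUp K Δβ T β p with hc1def
  refine ⟨L₁ ^ 2 * (L₁ ^ 2 + c1) * Real.exp (L₁ ^ 2 * (Lf ^ 2 / c0) * T), by positivity, ?_⟩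
  intro N M₁ M₂ hN hM₁ hM₂ τ h₁ h₂ μ hτ hh₁ hh₂ hμ f hf u ut ψ₂ ψ₂t hbd hu hut n _ hnN
  have hNpos : (0 : ℝ) < N := by exact_mod_cast hN
  have hτpos : 0 < τ := by rw [hτ]; positivity
  have hTN : T = N * τ := by rw [hτ]; field_simp
  have hM₁pos : (0 : ℝ) < M₁ := by exact_mod_cast (by omega : 0 < M₁)
  have hM₂pos : (0 : ℝ) < M₂ := by exact_mod_cast (by omega : 0 < M₂)
  have hh : 0 < h₁ * h₂ := by rw [hh₁, hh₂]; positivity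
  have hμpos : 0 < μ := by
    rw [hμ]
    refine mul_pos hΔβ (Finset.sum_pos (fun l hl => ?_) ⟨1, by simp [hK]⟩)
    have hb := hβ l hl
    have := hp l hl
    have hG : 0 < Real.Gamma (3 - β l) := Real.Gamma_pos_of_pos (by linarith)
    positivity
  let e : ℕ → ℕ → ℕ → ℝ := fun n i j => u n i j - ut n i j
  let d : ℕ → ℕ → ℕ → ℝ := fun n i j => (e (n + 1) i j - e n i j) / τ
  let ψ : ℕ → ℕ → ℝ := fun i j => ψ₂ i j - ψ₂t i j
  have hz : ∀ m ≤ N, ZB M₁ M₂ (e m) := fun m hm i j hi hj hb => by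
    simp only [e, hbd m hm i j hi hj hb, sub_self]
  have hP := time_energy (AA K Δβ τ β p) (fun k => iS M₁ M₂ (fun i j => d k i j ^ 2))
    (fun k => iS M₁ M₂ (fun i j => e k i j ^ 2)) (fun k => gS h₁ h₂ M₁ M₂ (e k) (e k))
    τ (iS M₁ M₂ (fun i j => ψ i j ^ 2)) c0 (Lf ^ 2 / c0) N hτpos
    (fun k => iS_sq_nonneg _ _ _)
    (fun k hk => AA_lower K N Δβ τ T β p hΔβ hτpos hTN hβ hp k hk)
    (fun m hm => step_ineq M₁ M₂ (by omega) (by omega) h₁ h₂ τ μ Lf c0 hτpos hμpos hc0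
      (AA K Δβ τ β p) (AA_anti K Δβ τ β p hΔβ hτpos hβ hp) (AA_nonneg K Δβ τ β p hΔβ hτpos hβ hp)
      e d ψ _ (fun _ _ _ => rfl) m (hz m (by omega)) (hz (m + 1) (by omega))
      (fun i j hi hi' hj hj' => hf i j hi hi' hj hj' (((m + 1 : ℕ) - 1 : ℝ) * τ) (u m i j) (ut m i j))
      (fun i j hi hi' hj hj' => point_eq M₁ M₂ N K h₁ h₂ τ Δβ μ β p hτpos f u ut ψ₂ ψ₂t hu hut e d
        (fun _ _ _ => rfl) (fun _ _ _ => rfl) m hm i j hi hi' hj hj'))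
  have hlap := grad_le_lap L₁ h₁ h₂ M₁ M₂ (by omega) (by omega) hL₁ hh₁ (e 0) (hz 0 (by omega))
  have hΨ : 0 ≤ iS M₁ M₂ (fun i j => ψ i j ^ 2) := iS_sq_nonneg _ _ _
  have hΛ : 0 ≤ iS M₁ M₂ (fun i j => (deltaXSq h₁ (e 0) i j + deltaYSq h₂ (e 0) i j) ^ 2) :=
    iS_sq_nonneg _ _ _
  set Ψ := iS M₁ M₂ (fun i j => ψ i j ^ 2) with hΨdef
  set Λ := iS M₁ M₂ (fun i j => (deltaXSq h₁ (e 0) i j + deltaYSq h₂ (e 0) i j) ^ 2) with hΛdef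
  have hgr := gronwall (fun k => iS M₁ M₂ (fun i j => e k i j ^ 2))
    (L₁ ^ 2 * (L₁ ^ 2 * Λ + c1 * Ψ)) (L₁ ^ 2 * (Lf ^ 2 / c0) * τ) N (by positivity)
    (by
      intro k hk
      have h1 := poincare2 L₁ h₁ h₂ M₁ M₂ (by omega) hL₁ hh₁ (e k) (hz k hk)
      have h2 := hP k hk
      have h3 := mul_le_mul_of_nonneg_right (AA_sum K N Δβ τ T β p hΔβ hτpos hTN hβ hp k hk) hΨ
      have h4 : gS h₁ h₂ M₁ M₂ (e k) (e k) ≤ L₁ ^ 2 * Λ + c1 * Ψ +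
        τ * (Lf ^ 2 / c0) * ∑ r ∈ range k, iS M₁ M₂ (fun i j => e r i j ^ 2) := by linarith
      have h5 := mul_le_mul_of_nonneg_left h4 (sq_nonneg L₁)
      linarith) n hnN
  have hexp : (1 + L₁ ^ 2 * (Lf ^ 2 / c0) * τ) ^ n ≤ Real.exp (L₁ ^ 2 * (Lf ^ 2 / c0) * T) := by
    have h1 : 1 + L₁ ^ 2 * (Lf ^ 2 / c0) * τ ≤ Real.exp (L₁ ^ 2 * (Lf ^ 2 / c0) * τ) := by
      rw [add_comm]; exact Real.add_one_le_exp _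
    refine (pow_le_pow_left₀ (by positivity) h1 n).trans ?_
    rw [← Real.exp_nat_mul, Real.exp_le_exp, hTN]
    have hnN' : (n : ℝ) ≤ N := by exact_mod_cast hnN
    have h2 : 0 ≤ L₁ ^ 2 * (Lf ^ 2 / c0) * τ := by positivity
    nlinarith [mul_le_mul_of_nonneg_right hnN' h2]
  have hfin : iS M₁ M₂ (fun i j => e n i j ^ 2)
      ≤ L₁ ^ 2 * (L₁ ^ 2 + c1) * Real.exp (L₁ ^ 2 * (Lf ^ 2 / c0) * T) * (Λ + Ψ) := by
    refine hgr.trans ?_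
    have hB : L₁ ^ 2 * (L₁ ^ 2 * Λ + c1 * Ψ) ≤ L₁ ^ 2 * ((L₁ ^ 2 + c1) * (Λ + Ψ)) := by
      refine mul_le_mul_of_nonneg_left ?_ (sq_nonneg _)
      nlinarith [mul_nonneg (sq_nonneg L₁) hΨ, mul_nonneg hc1.le hΛ]
    calc _ ≤ (L₁ ^ 2 * ((L₁ ^ 2 + c1) * (Λ + Ψ))) * Real.exp (L₁ ^ 2 * (Lf ^ 2 / c0) * T) :=
          mul_le_mul hB hexp (by positivity) (by positivity)
      _ = _ := by ring
  have := mul_le_mul_of_nonneg_left hfin hh.le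
  have e1 : gridNormSq h₁ h₂ M₁ M₂ (fun i j => u n i j - ut n i j)
      = h₁ * h₂ * iS M₁ M₂ (fun i j => e n i j ^ 2) := rfl
  have e2 : gridNormSq h₁ h₂ M₁ M₂ (fun i j => ψ₂ i j - ψ₂t i j) = h₁ * h₂ * Ψ := rfl
  have e3 : lapNormSq h₁ h₂ M₁ M₂ (fun i j => u 0 i j - ut 0 i j) = h₁ * h₂ * Λ := rfl
  rw [e1, e2, e3]
  linarith
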